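/- Let $T \in \mathfrak{P}_n$ and suppose $T$ has a completion in the homeomorphism group of $\mathfrak{C}_n$. Then the derived subgroup $[\mathcal{F}(T), \mathcal{F}(T)]$ of the group $\mathcal{F}(T)$ of all homeomorphisms locally agreeing with $\mathcal{H}(T)$ is simple. -/

import Mathlib

open Classical

noncomputable section

/-- `n`-ary Cantor space: infinite words over the alphabet `Fin n`. -/
abbrev Cantor (n : ℕ) : Type := ℕ → Fin n

/-- The finite word `w` is a prefix of the infinite word `χ`. -/
def PrefixOf {n : ℕ} (w : List (Fin n)) (χ : Cantor n) : Prop :=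
  ∀ (i : ℕ) (h : i < w.length), w.get ⟨i, h⟩ = χ i

/-- Concatenation of a finite word with an infinite word. -/
def appendInf {n : ℕ} (w : List (Fin n)) (χ : Cantor n) : Cantor n :=
  fun i => if h : i < w.length then w.get ⟨i, h⟩ else χ (i - w.length)

/-- The cone (basic clopen set) of infinite words having the finite word `w` as prefix. -/
def cone {n : ℕ} (w : List (Fin n)) : Set (Cantor n) :=
  {χ | PrefixOf w χ}

/-- The length-`k` prefix of an infinite word, as a finite word. -/
def takeW {n : ℕ} (χ : Cantor n) (k : ℕ) : List (Fin n) :=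
  List.ofFn (fun i : Fin k => χ i)

/-- A finite family of finite words forming a maximal antichain:
every infinite word has exactly one member of the family as a prefix. -/
def AntichainFam {n m : ℕ} (α : Fin m → List (Fin n)) : Prop :=
  ∀ χ : Cantor n, ∃! i : Fin m, PrefixOf (α i) χ

/-- The group structure on self-homeomorphisms of a topological space,
with `f * g` acting as `g` followed by `f`. -/
instance homeoGroup {X : Type*} [TopologicalSpace X] : Group (X ≃ₜ X) where
  mul f g := g.trans f
  one := Homeomorph.refl X
  inv := Homeomorph.symm
  mul_assoc a b c := Homeomorph.ext fun _ => rfl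
  one_mul a := Homeomorph.ext fun _ => rfl
  mul_one a := Homeomorph.ext fun _ => rfl
  inv_mul_cancel a := Homeomorph.ext fun x => a.symm_apply_apply x

/-- The Higman–Thompson group `Vₙ`, as the set of self-homeomorphisms of Cantor space
which act by exchanging finite prefixes along a pair of maximal antichains. -/
def Vn (n : ℕ) : Set (Cantor n ≃ₜ Cantor n) :=
  {g | ∃ (m : ℕ) (α β : Fin m → List (Fin n)), AntichainFam α ∧ AntichainFam β ∧
      ∀ (i : Fin m) (χ : Cantor n), g (appendInf (α i) χ) = appendInf (β i) χ}

/-- Conjugation in the paper's right-action convention: `paperConj g v = g⁻¹ v g`,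
i.e. the homeomorphism `x ↦ (x) g⁻¹ v g` (first apply `g⁻¹`, then `v`, then `g`). -/
def paperConj {n : ℕ} (g v : Cantor n ≃ₜ Cantor n) : Cantor n ≃ₜ Cantor n :=
  (g.symm.trans v).trans g

/-- `l` is the longest common prefix of the set `A` of infinite words. -/
def IsLCP {n : ℕ} (A : Set (Cantor n)) (l : List (Fin n)) : Prop :=
  (∀ ρ ∈ A, PrefixOf l ρ) ∧
    ∀ l' : List (Fin n), (∀ ρ ∈ A, PrefixOf l' ρ) → l'.length ≤ l.length

/-- A (not necessarily finite-state) transducer over the alphabet `Fin n`. -/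
structure Transducer (n : ℕ) where
  /-- the set of states -/
  Q : Type
  /-- the transition function -/
  tr : Fin n → Q → Q
  /-- the output (rewrite) function -/
  out : Fin n → Q → List (Fin n)

namespace Transducer

variable {n : ℕ}

/-- The transition function extended to finite words. -/
def transStar (T : Transducer n) : List (Fin n) → T.Q → T.Q
  | [], q => q
  | x :: w, q => T.transStar w (T.tr x q)

/-- The output function extended to finite words. -/
def outStar (T : Transducer n) : List (Fin n) → T.Q → List (Fin n)
  | [], _ => []
  | x :: w, q => T.out x q ++ T.outStar w (T.tr x q)

/-- The initial transducer `T_q` induces the map `f` on Cantor space: the outputs along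
ever longer prefixes of `χ` are ever longer prefixes of `f χ`. -/
def Induces (T : Transducer n) (q : T.Q) (f : Cantor n → Cantor n) : Prop :=
  ∀ (χ : Cantor n) (m : ℕ), ∃ k : ℕ,
    m ≤ (T.outStar (takeW χ k) q).length ∧ PrefixOf (T.outStar (takeW χ k) q) (f χ)

/-- The image of the state `q`: the image of Cantor space under the map induced by `T_q`. -/
def stateImage (T : Transducer n) (q : T.Q) : Set (Cantor n) :=
  {y | ∃ (f : Cantor n → Cantor n) (χ : Cantor n), T.Induces q f ∧ f χ = y}

/-- `T` is synchronizing at level `k`: the state reached after reading any word of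
length `k` does not depend on the starting state. -/
def SyncAtLevel (T : Transducer n) (k : ℕ) : Prop :=
  ∀ w : List (Fin n), w.length = k → ∀ q q' : T.Q, T.transStar w q = T.transStar w q'

/-- `T` is synchronizing if it is synchronizing at some level. -/
def Synchronizing (T : Transducer n) : Prop := ∃ k, T.SyncAtLevel k

/-- `T` (inducing the homeomorphism `h` at `q0`) is one-way synchronizing: `T` is
synchronizing, but the inverse homeomorphism is not induced by any finite
synchronizing transducer (equivalently, the inverse transducer is not synchronizing). -/
def OneWaySync (T : Transducer n) (q0 : T.Q) (h : Cantor n ≃ₜ Cantor n) : Prop :=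
  T.Induces q0 ⇑h ∧ T.Synchronizing ∧
    ¬ ∃ (S : Transducer n) (_ : Finite S.Q) (s0 : S.Q),
        S.Induces s0 ⇑h.symm ∧ S.Synchronizing

/-- `T` is equal to its core : every state is reached by reading a word of length `k`
from some state, for every synchronizing level `k`. -/
def EqualToCore (T : Transducer n) : Prop :=
  ∀ k : ℕ, T.SyncAtLevel k → ∀ q : T.Q, ∃ (w : List (Fin n)) (p : T.Q),
    w.length = k ∧ T.transStar w p = q

/-- Every state of `T` is accessible from `q0`. -/
def Accessible (T : Transducer n) (q0 : T.Q) : Prop :=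
  ∀ q : T.Q, ∃ w : List (Fin n), T.transStar w q0 = q

/-- The product transducer `T S` (first act by `T`, then by `S`). -/
def prod (T S : Transducer n) : Transducer n where
  Q := T.Q × S.Q
  tr := fun x p => (T.tr x p.1, S.transStar (T.out x p.1) p.2)
  out := fun x p => S.outStar (T.out x p.1) p.2

/-- `T` is partially invertible: every state induces an injective map on Cantor space
with clopen image. -/
def PartiallyInvertible (T : Transducer n) : Prop :=
  ∀ q : T.Q, ∃ f : Cantor n → Cantor n,
    T.Induces q f ∧ Function.Injective f ∧ IsClopen (Set.range f)

/-- `T` has no states of incomplete response: for each state `q` and letter `i`, no word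
strictly longer than `λ(i,q)` is a common prefix of the outputs on all of the cone `[i]`. -/
def NoIncompleteResponse (T : Transducer n) : Prop :=
  ∀ (q : T.Q) (i x : Fin n),
    ¬ ∀ χ : Cantor n, ∃ k : ℕ, (T.out i q ++ [x]) <+: T.outStar (i :: takeW χ k) q

/-- States `q` of `T` and `p` of `S` are `ω`-equivalent: they induce one and the same
map on Cantor space. -/
def OmegaEq (T : Transducer n) (q : T.Q) (S : Transducer n) (p : S.Q) : Prop :=
  ∃ f : Cantor n → Cantor n, T.Induces q f ∧ S.Induces p f

/-- `T` is minimal: no states of incomplete response and no pair of distinct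
`ω`-equivalent states. -/
def Minimal (T : Transducer n) : Prop :=
  T.NoIncompleteResponse ∧ ∀ q q' : T.Q, T.OmegaEq q T q' → q = q'

/-- The map on Cantor space induced by the state `q` (junk value if none exists). -/
def inducedMap (T : Transducer n) (q : T.Q) : Cantor n → Cantor n :=
  if h : ∃ f, T.Induces q f then h.choose else id

/-- `𝓛_q(α)`: the longest common prefix of the preimage of the cone `[α]` under `T_q`
(junk value if it does not exist). -/
def lcp (T : Transducer n) (q : T.Q) (α : List (Fin n)) : List (Fin n) :=
  if h : ∃ l, IsLCP {ρ : Cantor n | T.inducedMap q ρ ∈ cone α} l then h.choose else []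

/-- The inverse transducer of `T` given by the inversion algorithm, on the set of all
pairs `(w, q)`: reading `x` from `(w,q)` outputs `𝓛_q(wx)` and moves to
`(wx - λ(𝓛_q(wx), q), π(𝓛_q(wx), q))`. -/
def invT (T : Transducer n) : Transducer n where
  Q := List (Fin n) × T.Q
  tr := fun x p =>
    ((p.1 ++ [x]).drop (T.outStar (T.lcp p.2 (p.1 ++ [x])) p.2).length,
      T.transStar (T.lcp p.2 (p.1 ++ [x])) p.2)
  out := fun x p => T.lcp p.2 (p.1 ++ [x])

/-- Restriction of a transducer to a set of states (transitions leaving the set are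
replaced by junk loops; for transition-closed sets this is the honest restriction). -/
def restrictTo (T : Transducer n) (P : T.Q → Prop) : Transducer n where
  Q := {q : T.Q // P q}
  tr := fun x q => if h : P (T.tr x q.1) then ⟨T.tr x q.1, h⟩ else q
  out := fun x q => T.out x q.1

/-- The set of states reachable from `q0`. -/
def reach (T : Transducer n) (q0 : T.Q) : T.Q → Prop :=
  fun q => ∃ w : List (Fin n), T.transStar w q0 = q

/-- The inverse transducer of the initial transducer `T_{q0}`, with state set the states
accessible from `(ε, q0)`. -/
def invAcc (T : Transducer n) (q0 : T.Q) : Transducer n :=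
  (T.invT).restrictTo ((T.invT).reach ([], q0))

/-- A pair `(w,p)` is good if `[w] ⊆ im(T_p)` and `𝓛_p(w) = ε`. -/
def GoodPair (T : Transducer n) (p : List (Fin n) × T.Q) : Prop :=
  cone p.1 ⊆ T.stateImage p.2 ∧
    IsLCP {ρ : Cantor n | T.inducedMap p.2 ρ ∈ cone p.1} []

/-- The partial inverse `T'` of a partially invertible transducer `T`: the inverse
transducer restricted to the good pairs `(w,p)` with `[w] ⊆ im(T_p)`, `𝓛_p(w) = ε`. -/
def partialInv (T : Transducer n) : Transducer n :=
  (T.invT).restrictTo T.GoodPair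

/-- `h` is a completion of `T`: there are a maximal antichain `η` and an effective viable
combination `(ρ, p)` such that `h` maps `η_i χ` to `ρ_i (χ)T_{p_i}`. -/
def IsCompletion (T : Transducer n) (h : Cantor n ≃ₜ Cantor n) : Prop :=
  ∃ (l : ℕ) (η ρ : Fin l → List (Fin n)) (p : Fin l → T.Q)
      (f : Fin l → (Cantor n → Cantor n)),
    l % (n - 1) = 1 % (n - 1) ∧
    AntichainFam η ∧
    (∀ i, T.Induces (p i) (f i)) ∧
    (⋃ i, appendInf (ρ i) '' Set.range (f i)) = Set.univ ∧
    (∀ i j, i ≠ j →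
      Disjoint (appendInf (ρ i) '' Set.range (f i))
        (appendInf (ρ j) '' Set.range (f j))) ∧
    ∀ (i : Fin l) (χ : Cantor n), h (appendInf (η i) χ) = appendInf (ρ i) (f i χ)

/-- The group `𝓗(T)` generated by all completions of `T`. -/
def HGroup (T : Transducer n) : Subgroup (Cantor n ≃ₜ Cantor n) :=
  Subgroup.closure {h | T.IsCompletion h}

/-- The subgroup-generating equivalence relation induced by the automaton underlying a
transducer `A` with start state `a0` (by Lemma 4.1, two words are related iff the states
they reach are identified by the collapsing procedure, i.e. iff the reached states
transition identically on all sufficiently long words). -/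
def simA (A : Transducer n) (a0 : A.Q) (α β : List (Fin n)) : Prop :=
  ∃ i : ℕ, ∀ w : List (Fin n), w.length = i →
    A.transStar w (A.transStar α a0) = A.transStar w (A.transStar β a0)

/-- `if b then T else T'`. -/
def factor (T : Transducer n) (b : Bool) : Transducer n :=
  if b then T else T.partialInv

/-- The product of a nonempty list of factors, each equal to `T` or its partial
inverse `T'`; these products make up the set `Π(T)`. -/
def prodOf (T : Transducer n) : List Bool → Transducer n
  | [] => T
  | [b] => T.factor b
  | b :: c :: rest => (T.factor b).prod (T.prodOf (c :: rest))

/-- `T` is contracting: every state of every product of copies of `T` and `T'` is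
`ω`-equivalent to an initial transducer which, after reading some fixed length of input,
always acts as a state of `T`. -/
def Contracting (T : Transducer n) : Prop :=
  ∀ L : List Bool, L ≠ [] → ∀ q : (T.prodOf L).Q,
    ∃ (V : Transducer n) (p : V.Q) (f : Cantor n → Cantor n),
      (T.prodOf L).Induces q f ∧ V.Induces p f ∧
      ∃ j : ℕ, ∀ w : List (Fin n), w.length = j →
        ∃ (u : T.Q) (g : Cantor n → Cantor n),
          V.Induces (V.transStar w p) g ∧ T.Induces u g

end Transducer

/-- The element `v` of `Vₙ` preserves the relation `r` on nonempty finite words: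
whenever `v` replaces the prefix `α` by `β`, the words `α` and `β` are related. -/
def PreservesRel {n : ℕ} (r : List (Fin n) → List (Fin n) → Prop)
    (g : Cantor n ≃ₜ Cantor n) : Prop :=
  ∀ (α β : List (Fin n)), α ≠ [] → β ≠ [] →
    (∀ χ : Cantor n, g (appendInf α χ) = appendInf β χ) → r α β

/-- The subgroup `V_∼` of `Vₙ` generated by the prefix-exchange homeomorphisms
preserving the relation `r`. -/
def VSim (n : ℕ) (r : List (Fin n) → List (Fin n) → Prop) :
    Subgroup (Cantor n ≃ₜ Cantor n) :=
  Subgroup.closure {g | g ∈ Vn n ∧ PreservesRel r g}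

/-- `f` coincides with `g` on the cone `[α]` (conjugated into the cone) and is the
identity off the cone: the homeomorphism `[α]_g`. -/
def IsRestrTo {n : ℕ} (α : List (Fin n)) (g f : Cantor n ≃ₜ Cantor n) : Prop :=
  (∀ χ : Cantor n, f (appendInf α χ) = appendInf α (g χ)) ∧
  ∀ χ : Cantor n, ¬ PrefixOf α χ → f χ = χ

/-- The Nekrashevych group `Vₙ(G)`: the group generated by `Vₙ` together with all the
homeomorphisms `[α]_g` for `g ∈ G`. -/
def NekG (n : ℕ) (G : Subgroup (Cantor n ≃ₜ Cantor n)) :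
    Subgroup (Cantor n ≃ₜ Cantor n) :=
  Subgroup.closure (Vn n ∪ {f | ∃ (α : List (Fin n)) (g : Cantor n ≃ₜ Cantor n),
    g ∈ G ∧ IsRestrTo α g f})

/-- The homeomorphism `f` locally agrees with the set `G` of homeomorphisms. -/
def LocallyAgrees {n : ℕ} (G : Set (Cantor n ≃ₜ Cantor n))
    (f : Cantor n ≃ₜ Cantor n) : Prop :=
  ∀ x : Cantor n, ∃ U : Set (Cantor n), IsOpen U ∧ x ∈ U ∧
    ∃ g ∈ G, Set.EqOn ⇑f ⇑g U

/-- A finite synchronous invertible transducer over `Fin n`: each state rewrites single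
letters to single letters bijectively. -/
structure SyncTransducer (n : ℕ) where
  /-- the set of states -/
  Q : Type
  /-- there are finitely many states -/
  fin : Finite Q
  /-- the transition function -/
  tr : Fin n → Q → Q
  /-- the (single-letter) output function -/
  out : Fin n → Q → Fin n
  /-- each state rewrites letters bijectively -/
  bij : ∀ q : Q, Function.Bijective fun x => out x q

namespace SyncTransducer

variable {n : ℕ}

/-- The transition function extended to finite words. -/
def trStar (U : SyncTransducer n) : List (Fin n) → U.Q → U.Q
  | [], q => q
  | x :: w, q => U.trStar w (U.tr x q)

/-- The output function extended to finite words. -/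
def outWord (U : SyncTransducer n) : List (Fin n) → U.Q → List (Fin n)
  | [], _ => []
  | x :: w, q => U.out x q :: U.outWord w (U.tr x q)

/-- The map on Cantor space induced by the initial transducer `U_q`. -/
def applyFun (U : SyncTransducer n) (q : U.Q) (χ : Cantor n) : Cantor n :=
  fun i => U.out (χ i) (U.trStar (takeW χ i) q)

/-- The inverse transducer of a synchronous invertible transducer. -/
def inv (U : SyncTransducer n) : SyncTransducer n where
  Q := U.Q
  fin := U.fin
  tr := fun y q => U.tr ((Equiv.ofBijective _ (U.bij q)).symm y) q
  out := fun y q => (Equiv.ofBijective _ (U.bij q)).symm y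
  bij := fun q => (Equiv.ofBijective _ (U.bij q)).symm.bijective

/-- The product of synchronous transducers (first act by `T`, then by `S`). -/
def sprod (T S : SyncTransducer n) : SyncTransducer n where
  Q := T.Q × S.Q
  fin := by
    haveI := T.fin; haveI := S.fin
    infer_instance
  tr := fun x p => (T.tr x p.1, S.tr (T.out x p.1) p.2)
  out := fun x p => S.out (T.out x p.1) p.2
  bij := fun p => (S.bij p.2).comp (T.bij p.1)

/-- `U` is synchronizing at level `k`. -/
def SyncAtLevel (U : SyncTransducer n) (k : ℕ) : Prop :=
  ∀ w : List (Fin n), w.length = k → ∀ q q' : U.Q, U.trStar w q = U.trStar w q'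

/-- `U` is synchronizing. -/
def Synchronizing (U : SyncTransducer n) : Prop := ∃ k, U.SyncAtLevel k

/-- `U` is minimal (under `ω`-equivalence): distinct states induce distinct maps. -/
def Minimal (U : SyncTransducer n) : Prop :=
  ∀ q q' : U.Q, U.applyFun q = U.applyFun q' → q = q'

/-- One-way synchronizing: `U` is synchronizing but the inverse homeomorphism of
`h = U_{q0}` is not induced by any finite synchronizing transducer. -/
def OneWaySync (U : SyncTransducer n) (h : Cantor n ≃ₜ Cantor n) : Prop :=
  U.Synchronizing ∧
    ¬ ∃ (S : Transducer n) (_ : Finite S.Q) (s0 : S.Q),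
        S.Induces s0 ⇑h.symm ∧ S.Synchronizing

/-- `U` is equal to its core. -/
def EqualToCore (U : SyncTransducer n) : Prop :=
  ∀ k : ℕ, U.SyncAtLevel k → ∀ q : U.Q, ∃ (w : List (Fin n)) (p : U.Q),
    w.length = k ∧ U.trStar w p = q

/-- The underlying (asynchronous-format) transducer of a synchronous transducer. -/
def toT (U : SyncTransducer n) : Transducer n :=
  ⟨U.Q, U.tr, fun x q => [U.out x q]⟩

/-- The automaton group `𝒢(U)` generated by `U`: the subgroup of the homeomorphism
group of Cantor space generated by the homeomorphisms `U_q` for the states `q`. -/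
def autG (U : SyncTransducer n) : Subgroup (Cantor n ≃ₜ Cantor n) :=
  Subgroup.closure {f : Cantor n ≃ₜ Cantor n | ∃ q : U.Q, ⇑f = U.applyFun q}

end SyncTransducer


section FlexibleGroups

open scoped commutatorElement

section CommutatorIdentities

variable {G : Type*} [Group G]

lemma commutator_mem_of_commutator_mem {K : Subgroup G} {a b : G} (h : ⁅a, b⁆ ∈ K) :
    ⁅b, a⁆ ∈ K :=
  commutatorElement_inv a b ▸ K.inv_mem h

lemma mul_commutator_mem {K : Subgroup G} {a₁ a₂ b : G}
    (hconj : ∀ k ∈ K, a₁ * k * a₁⁻¹ ∈ K) (h₁ : ⁅a₁, b⁆ ∈ K) (h₂ : ⁅a₂, b⁆ ∈ K) :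
    ⁅a₁ * a₂, b⁆ ∈ K := by
  have : ⁅a₁ * a₂, b⁆ = a₁ * ⁅a₂, b⁆ * a₁⁻¹ * ⁅a₁, b⁆ := by
    simp only [commutatorElement_def]; group
  rw [this]
  exact K.mul_mem (hconj _ h₂) h₁

lemma commutator_mul_left_of_commute {a b c : G} (h : Commute c b) : ⁅a * c, b⁆ = ⁅a, b⁆ := by
  have : c * b * c⁻¹ = b := by rw [h.eq, mul_inv_cancel_right]
  calc ⁅a * c, b⁆ = a * (c * b * c⁻¹) * a⁻¹ * b⁻¹ := by
        simp only [commutatorElement_def]; group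
    _ = ⁅a, b⁆ := by rw [this, commutatorElement_def]

lemma commutator_mul_right_of_commute {a b c : G} (h : Commute a c) :
    ⁅a, b * c⁆ = ⁅a, b⁆ := by
  have : c * a⁻¹ * c⁻¹ = a⁻¹ := by rw [h.symm.inv_right.eq, mul_inv_cancel_right]
  calc ⁅a, b * c⁆ = a * b * (c * a⁻¹ * c⁻¹) * b⁻¹ := by
        simp only [commutatorElement_def]; group
    _ = ⁅a, b⁆ := by rw [this, commutatorElement_def]

end CommutatorIdentities

variable {X : Type*} [TopologicalSpace X]

@[simp] lemma homeo_mul_apply (f g : X ≃ₜ X) (x : X) : (f * g) x = f (g x) := rfl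

@[simp] lemma homeo_one_apply (x : X) : (1 : X ≃ₜ X) x = x := rfl

@[simp] lemma homeo_inv_apply_self (f : X ≃ₜ X) (x : X) : f⁻¹ (f x) = x :=
  f.symm_apply_apply x

@[simp] lemma homeo_apply_inv_self (f : X ≃ₜ X) (x : X) : f (f⁻¹ x) = x :=
  f.apply_symm_apply x

/-- The homeomorphism `f` fixes every point outside `A`. -/
def SupportedIn (A : Set X) (f : X ≃ₜ X) : Prop := ∀ x, x ∉ A → f x = x

namespace SupportedIn

variable {A B : Set X} {f g : X ≃ₜ X}

lemma mono (h : SupportedIn A f) (hAB : A ⊆ B) : SupportedIn B f :=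
  fun x hx => h x fun hA => hx (hAB hA)

lemma inv (h : SupportedIn A f) : SupportedIn A f⁻¹ := fun x hx => by
  conv_lhs => rw [← h x hx]
  simp

lemma mul (h : SupportedIn A f) (h' : SupportedIn A g) : SupportedIn A (f * g) :=
  fun x hx => by rw [homeo_mul_apply, h' x hx, h x hx]

lemma apply_mem (h : SupportedIn A f) {x : X} (hx : x ∈ A) : f x ∈ A := by
  by_contra hfx
  exact hfx ((f.injective (h _ hfx)).symm ▸ hx)

lemma conj (h : SupportedIn A f) (t : X ≃ₜ X) (ht : ∀ x ∈ A, t x ∈ B) :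
    SupportedIn B (t * f * t⁻¹) := fun x hx => by
  have hA : t⁻¹ x ∉ A := fun hA => hx (by simpa using ht _ hA)
  simp only [homeo_mul_apply, h _ hA, homeo_apply_inv_self]

lemma commute (hf : SupportedIn A f) (hg : SupportedIn B g) (hAB : Disjoint A B) :
    Commute f g := by
  refine Homeomorph.ext fun x => ?_
  simp only [homeo_mul_apply]
  by_cases hA : x ∈ A
  · rw [hg x (hAB.notMem_of_mem_left hA), hg _ (hAB.notMem_of_mem_left (hf.apply_mem hA))]
  · rw [hf x hA]
    by_cases hB : x ∈ B
    · exact hf _ (hAB.notMem_of_mem_right (hg.apply_mem hB))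
    · rw [hg x hB, hf x hA]

end SupportedIn

/-- The involution exchanging two disjoint clopen sets `A` and `B` by mutually inverse maps. -/
def clopenSwap {A B : Set X} (hA : IsClopen A) (hB : IsClopen B) (hAB : Disjoint A B)
    {j k : X → X} (hj : Continuous j) (hk : Continuous k)
    (hjB : ∀ x ∈ A, j x ∈ B) (hkA : ∀ x ∈ B, k x ∈ A)
    (hkj : ∀ x ∈ A, k (j x) = x) (hjk : ∀ x ∈ B, j (k x) = x) : X ≃ₜ X :=
  have hinv : Function.Involutive (A.piecewise j (B.piecewise k id)) := fun x => by
    by_cases h1 : x ∈ A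
    · have h2 := hjB x h1
      simp [h1, h2, hAB.notMem_of_mem_right h2, hkj x h1]
    · by_cases h2 : x ∈ B
      · simp [h1, h2, hkA x h2, hjk x h2]
      · simp [h1, h2]
  have hcont : Continuous (A.piecewise j (B.piecewise k id)) := by
    refine hj.piecewise ?_ (hk.piecewise ?_ continuous_id)
    · simp [hA.frontier_eq]
    · simp [hB.frontier_eq]
  { toEquiv := hinv.toPerm
    continuous_toFun := hcont
    continuous_invFun := hcont }

section ClopenSwap

variable {A B : Set X} {hA : IsClopen A} {hB : IsClopen B} {hAB : Disjoint A B}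
    {j k : X → X} {hj : Continuous j} {hk : Continuous k}
    {hjB : ∀ x ∈ A, j x ∈ B} {hkA : ∀ x ∈ B, k x ∈ A}
    {hkj : ∀ x ∈ A, k (j x) = x} {hjk : ∀ x ∈ B, j (k x) = x}

lemma clopenSwap_apply_left {x : X} (hx : x ∈ A) :
    clopenSwap hA hB hAB hj hk hjB hkA hkj hjk x = j x :=
  Set.piecewise_eq_of_mem _ _ _ hx

lemma clopenSwap_apply_right {x : X} (hx : x ∈ B) :
    clopenSwap hA hB hAB hj hk hjB hkA hkj hjk x = k x :=
  (Set.piecewise_eq_of_notMem _ _ _ (hAB.notMem_of_mem_right hx)).trans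
    (Set.piecewise_eq_of_mem _ _ _ hx)

lemma clopenSwap_apply_of_notMem {x : X} (hxA : x ∉ A) (hxB : x ∉ B) :
    clopenSwap hA hB hAB hj hk hjB hkA hkj hjk x = x :=
  (Set.piecewise_eq_of_notMem _ _ _ hxA).trans (Set.piecewise_eq_of_notMem _ _ _ hxB)

end ClopenSwap

/-- `F` contains every homeomorphism which locally agrees with elements of `F`. -/
def LocallyClosed (F : Subgroup (X ≃ₜ X)) : Prop :=
  ∀ f : X ≃ₜ X, (∀ x, ∃ U : Set X, IsOpen U ∧ x ∈ U ∧ ∃ g ∈ F, Set.EqOn f g U) → f ∈ F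

lemma LocallyClosed.clopenSwap_mem {F : Subgroup (X ≃ₜ X)} (hF : LocallyClosed F)
    {A B : Set X} (hA : IsClopen A) (hB : IsClopen B) (hAB : Disjoint A B)
    {j k : X → X} (hj : Continuous j) (hk : Continuous k)
    (hjB : ∀ x ∈ A, j x ∈ B) (hkA : ∀ x ∈ B, k x ∈ A)
    (hkj : ∀ x ∈ A, k (j x) = x) (hjk : ∀ x ∈ B, j (k x) = x)
    (hloc : ∀ x ∈ A, ∃ U : Set X, IsOpen U ∧ x ∈ U ∧ ∃ g ∈ F, Set.EqOn j g U) :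
    clopenSwap hA hB hAB hj hk hjB hkA hkj hjk ∈ F := by
  refine hF _ fun x => ?_
  by_cases hxA : x ∈ A
  · obtain ⟨U, hU, hxU, g, hg, hjg⟩ := hloc x hxA
    refine ⟨U ∩ A, hU.inter hA.isOpen, ⟨hxU, hxA⟩, g, hg, fun z hz => ?_⟩
    rw [clopenSwap_apply_left hz.2, hjg hz.1]
  by_cases hxB : x ∈ B
  · obtain ⟨U, hU, hxU, g, hg, hjg⟩ := hloc (k x) (hkA x hxB)
    refine ⟨g '' (U ∩ A), g.isOpenMap _ (hU.inter hA.isOpen),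
      ⟨k x, ⟨hxU, hkA x hxB⟩, by rw [← hjg hxU, hjk x hxB]⟩, g⁻¹, F.inv_mem hg, ?_⟩
    rintro _ ⟨z, hz, rfl⟩
    rw [homeo_inv_apply_self, ← hjg hz.1, clopenSwap_apply_right (hjB z hz.2), hkj z hz.2]
  · refine ⟨Aᶜ ∩ Bᶜ, hA.isClosed.isOpen_compl.inter hB.isClosed.isOpen_compl, ⟨hxA, hxB⟩,
      1, F.one_mem, fun z hz => clopenSwap_apply_of_notMem hz.1 hz.2⟩

/-- A locally closed group of homeomorphisms which can move any clopen set into any nonempty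
open set disjoint from it. -/
structure IsFlexible (F : Subgroup (X ≃ₜ X)) : Prop where
  locallyClosed : LocallyClosed F
  exists_move : ∀ A V : Set X, IsClopen A → IsOpen V → V.Nonempty → Disjoint A V →
    ∃ f ∈ F, ∀ x ∈ A, f x ∈ V

lemma LocallyClosed.exists_swap {F : Subgroup (X ≃ₜ X)} (hF : LocallyClosed F)
    {f : X ≃ₜ X} (hf : f ∈ F) {U : Set X} (hU : IsClopen U) (hd : Disjoint U (f '' U)) :
    ∃ s ∈ F, (∀ x ∈ U, s x = f x) ∧ (∀ x ∈ U, s (f x) = x) ∧ SupportedIn (U ∪ f '' U) s := by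
  have hB : IsClopen (f '' U) := ⟨f.isClosedMap _ hU.isClosed, f.isOpenMap _ hU.isOpen⟩
  refine ⟨_, hF.clopenSwap_mem hU hB hd f.continuous f.symm.continuous
    (fun x hx => Set.mem_image_of_mem f hx) ?_ (fun x _ => f.symm_apply_apply x)
    (fun x _ => f.apply_symm_apply x)
    (fun x _ => ⟨Set.univ, isOpen_univ, trivial, f, hf, fun _ _ => rfl⟩), ?_, ?_, ?_⟩
  · rintro _ ⟨x, hx, rfl⟩
    simpa using hx
  · exact fun x hx => clopenSwap_apply_left hx
  · exact fun x hx => (clopenSwap_apply_right (Set.mem_image_of_mem f hx)).trans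
      (f.symm_apply_apply x)
  · exact fun x hx => clopenSwap_apply_of_notMem (fun h => hx (.inl h)) (fun h => hx (.inr h))

lemma IsFlexible.exists_swap {F : Subgroup (X ≃ₜ X)} (hF : IsFlexible F) {A V : Set X}
    (hA : IsClopen A) (hV : IsOpen V) (hne : V.Nonempty) (hd : Disjoint A V) :
    ∃ s ∈ F, (∀ x ∈ A, s x ∈ V) ∧ (∀ x ∈ A, s (s x) = x) ∧ SupportedIn (A ∪ V) s := by
  obtain ⟨f, hf, hfV⟩ := hF.exists_move A V hA hV hne hd
  have hsub : f '' A ⊆ V := Set.image_subset_iff.2 hfV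
  obtain ⟨s, hs, h1, h2, h3⟩ := hF.locallyClosed.exists_swap hf hA (hd.mono_right hsub)
  refine ⟨s, hs, fun x hx => h1 x hx ▸ hfV x hx, fun x hx => ?_,
    h3.mono (Set.union_subset_union_right _ hsub)⟩
  rw [h1 x hx, h2 x hx]

/-- The subgroup generated by commutators of pairs of elements of `F` which are supported in a
common proper clopen set. -/
def localCommutator (F : Subgroup (X ≃ₜ X)) : Subgroup (X ≃ₜ X) :=
  Subgroup.closure {c | ∃ A : Set X, IsClopen A ∧ A ≠ Set.univ ∧ ∃ a ∈ F, ∃ b ∈ F,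
    SupportedIn A a ∧ SupportedIn A b ∧ ⁅a, b⁆ = c}

lemma commutator_mem_localCommutator {F : Subgroup (X ≃ₜ X)} {A : Set X} {a b : X ≃ₜ X}
    (hA : IsClopen A) (hA' : A ≠ Set.univ) (ha : a ∈ F) (hb : b ∈ F)
    (hsa : SupportedIn A a) (hsb : SupportedIn A b) : ⁅a, b⁆ ∈ localCommutator F :=
  Subgroup.subset_closure ⟨A, hA, hA', a, ha, b, hb, hsa, hsb, rfl⟩
lemma conj_mem_localCommutator {F : Subgroup (X ≃ₜ X)} {k t : X ≃ₜ X}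
    (hk : k ∈ localCommutator F) (ht : t ∈ F) : t * k * t⁻¹ ∈ localCommutator F := by
  have hle : localCommutator F ≤ (localCommutator F).comap (MulAut.conj t).toMonoidHom := by
    refine (Subgroup.closure_le _).2 ?_
    rintro _ ⟨A, hA, hA', a, ha, b, hb, hsa, hsb, rfl⟩
    have hcl : IsClopen (t '' A) := ⟨t.isClosedMap _ hA.isClosed, t.isOpenMap _ hA.isOpen⟩
    have hne : t '' A ≠ Set.univ := fun h =>
      hA' (t.injective.image_injective (h.trans (Set.image_univ_of_surjective t.surjective).symm))
    have hmem : ∀ x ∈ A, t x ∈ t '' A := fun x hx => Set.mem_image_of_mem t hx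
    have heq : t * ⁅a, b⁆ * t⁻¹ = ⁅t * a * t⁻¹, t * b * t⁻¹⁆ := by
      simp only [commutatorElement_def]; group
    change t * ⁅a, b⁆ * t⁻¹ ∈ localCommutator F
    rw [heq]
    exact commutator_mem_localCommutator hcl hne (mul_mem (mul_mem ht ha) (inv_mem ht))
      (mul_mem (mul_mem ht hb) (inv_mem ht)) (hsa.conj t hmem) (hsb.conj t hmem)
  exact hle hk

lemma exists_mem_ne_of_isOpen [PerfectSpace X] {U : Set X} (hU : IsOpen U) {x : X} (hx : x ∈ U) :
    ∃ y ∈ U, y ≠ x := by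
  obtain ⟨y, hy, hyx⟩ := preperfect_iff_nhds.1 PerfectSpace.univ_preperfect x trivial U
    (hU.mem_nhds hx)
  exact ⟨y, hy.1, hyx⟩

section CantorLike

variable [T2Space X] [CompactSpace X] [TotallyDisconnectedSpace X] [PerfectSpace X]

lemma exists_disjoint_clopen_subsets {U : Set X} (hU : IsOpen U) (hne : U.Nonempty) :
    ∃ V W : Set X, IsClopen V ∧ IsClopen W ∧ V.Nonempty ∧ W.Nonempty ∧ V ⊆ U ∧ W ⊆ U ∧
      Disjoint V W := by
  obtain ⟨x, hx⟩ := hne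
  obtain ⟨y, hy, hyx⟩ := exists_mem_ne_of_isOpen hU hx
  obtain ⟨V, hV, hxV, hVU⟩ := compact_exists_isClopen_in_isOpen
    (hU.inter isOpen_compl_singleton) (⟨hx, hyx.symm⟩ : x ∈ U ∩ {y}ᶜ)
  obtain ⟨W, hW, hyW, hWU⟩ := compact_exists_isClopen_in_isOpen
    (hU.inter hV.isClosed.isOpen_compl) (⟨hy, fun h => (hVU h).2 rfl⟩ : y ∈ U ∩ Vᶜ)
  exact ⟨V, W, hV, hW, ⟨x, hxV⟩, ⟨y, hyW⟩, fun z hz => (hVU hz).1, fun z hz => (hWU hz).1,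
    Set.disjoint_left.2 fun z hz hz' => (hWU hz').2 hz⟩

namespace IsFlexible

variable {F : Subgroup (X ≃ₜ X)}

lemma exists_commutator_move_of_disjoint (hF : IsFlexible F) {A V : Set X} (hA : IsClopen A)
    (hV : IsOpen V) (hne : V.Nonempty) (hd : Disjoint A V) :
    ∃ d ∈ ⁅F, F⁆, ∀ x ∈ A, d x ∈ V := by
  obtain ⟨V₁, V₂, hV₁, hV₂, hn₁, hn₂, hs₁, hs₂, h₁₂⟩ := exists_disjoint_clopen_subsets hV hne
  obtain ⟨s, hs, hsV, -, hsupp⟩ := hF.exists_swap hA hV₁.isOpen hn₁ (hd.mono_right hs₁)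
  obtain ⟨t, ht, htV, -, -⟩ := hF.exists_swap (hA.union hV₁) hV₂.isOpen hn₂
    (Set.disjoint_union_left.2 ⟨hd.mono_right hs₂, h₁₂⟩)
  refine ⟨⁅s, t⁆, Subgroup.commutator_mem_commutator hs ht, fun x hx => ?_⟩
  have hfix : (t * s⁻¹ * t⁻¹) x = x :=
    hsupp.inv.conj t htV x ((hd.mono_right hs₂).notMem_of_mem_left hx)
  have heq : ⁅s, t⁆ = s * (t * s⁻¹ * t⁻¹) := by simp only [commutatorElement_def, mul_assoc]
  rw [heq, homeo_mul_apply, hfix]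
  exact hs₁ (hsV x hx)

lemma exists_commutator_move (hF : IsFlexible F) {A V : Set X} (hA : IsClopen A)
    (hA' : A ≠ Set.univ) (hV : IsOpen V) (hne : V.Nonempty) :
    ∃ d ∈ ⁅F, F⁆, ∀ x ∈ A, d x ∈ V := by
  obtain ⟨e, he⟩ := (Set.ne_univ_iff_exists_notMem A).1 hA'
  obtain ⟨v, hv, hve⟩ : ∃ v ∈ V, v ≠ e := by
    obtain ⟨v, hv⟩ := hne
    by_cases h : v = e
    · subst h
      exact exists_mem_ne_of_isOpen hV hv
    · exact ⟨v, hv, h⟩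
  obtain ⟨C, hC, heC, hCs⟩ := compact_exists_isClopen_in_isOpen
    (hA.isClosed.isOpen_compl.inter isOpen_compl_singleton) (⟨he, hve.symm⟩ : e ∈ Aᶜ ∩ {v}ᶜ)
  obtain ⟨d₁, hd₁, h₁⟩ := hF.exists_commutator_move_of_disjoint hA hC.isOpen ⟨e, heC⟩
    (Set.disjoint_right.2 fun z hz => (hCs hz).1)
  obtain ⟨d₂, hd₂, h₂⟩ := hF.exists_commutator_move_of_disjoint (V := V ∩ Cᶜ) hC
    (hV.inter hC.isClosed.isOpen_compl) ⟨v, hv, fun h => (hCs h).2 rfl⟩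
    (Set.disjoint_right.2 fun z hz => hz.2)
  exact ⟨d₂ * d₁, mul_mem hd₂ hd₁, fun x hx => (h₂ _ (h₁ x hx)).1⟩

end IsFlexible

lemma exists_clopen_disjoint_image {f : X ≃ₜ X} {y : X} (hy : f y ≠ y) :
    ∃ U : Set X, IsClopen U ∧ y ∈ U ∧ Disjoint U (f '' U) ∧ U ∪ f '' U ≠ Set.univ := by
  obtain ⟨z, hz, hzy⟩ := exists_mem_ne_of_isOpen
    (isOpen_compl_singleton : IsOpen ({f y}ᶜ : Set X)) (Ne.symm hy : y ∈ ({f y}ᶜ : Set X))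
  obtain ⟨O₁, O₂, hO₁, hO₂, hy₁, hy₂, hd⟩ := t2_separation (Ne.symm hy)
  have hopen : IsOpen ((O₁ ∩ f ⁻¹' O₂) ∩ ({z}ᶜ ∩ f ⁻¹' {z}ᶜ)) :=
    (hO₁.inter (hO₂.preimage f.continuous)).inter
      (isOpen_compl_singleton.inter (isOpen_compl_singleton.preimage f.continuous))
  obtain ⟨U, hU, hyU, hsub⟩ := compact_exists_isClopen_in_isOpen hopen
    (⟨⟨hy₁, hy₂⟩, hzy.symm, fun h => hz (Eq.symm h)⟩ :
      y ∈ (O₁ ∩ f ⁻¹' O₂) ∩ ({z}ᶜ ∩ f ⁻¹' {z}ᶜ))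
  refine ⟨U, hU, hyU, ?_, (Set.ne_univ_iff_exists_notMem _).2 ⟨z, ?_⟩⟩
  · refine hd.mono (fun x hx => (hsub hx).1.1) ?_
    rintro _ ⟨x, hx, rfl⟩
    exact (hsub hx).1.2
  · rintro (h | ⟨x, hx, h⟩)
    · exact (hsub h).2.1 rfl
    · exact (hsub hx).2.2 h

namespace IsFlexible

variable {F : Subgroup (X ≃ₜ X)}

/-- Every element of `F` is a product of two elements with proper clopen supports. -/
lemma exists_fragmentation [Nonempty X] (hF : IsFlexible F) {f : X ≃ₜ X} (hf : f ∈ F) :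
    ∃ A B : Set X, IsClopen A ∧ A ≠ Set.univ ∧ IsClopen B ∧ B ≠ Set.univ ∧
      ∃ a ∈ F, ∃ b ∈ F, SupportedIn A a ∧ SupportedIn B b ∧ f = a * b := by
  by_cases h1 : ∀ x, f x = x
  · have : (∅ : Set X) ≠ Set.univ := Set.empty_ne_univ
    exact ⟨∅, ∅, isClopen_empty, this, isClopen_empty, this, f, hf, 1, F.one_mem,
      fun x _ => h1 x, fun x _ => rfl, (mul_one f).symm⟩
  push Not at h1
  obtain ⟨y, hy⟩ := h1
  obtain ⟨U, hU, hyU, hd, hne⟩ := exists_clopen_disjoint_image hy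
  obtain ⟨s, hs, -, h2, h3⟩ := hF.locallyClosed.exists_swap hf hU hd
  have hfU : IsClopen (f '' U) := ⟨f.isClosedMap _ hU.isClosed, f.isOpenMap _ hU.isOpen⟩
  refine ⟨U ∪ f '' U, Uᶜ, hU.union hfU, hne, hU.compl, fun h => ?_, s⁻¹, inv_mem hs, s * f,
    mul_mem hs hf, h3.inv, fun x hx => h2 x (not_not.1 hx), (inv_mul_cancel_left s f).symm⟩
  exact (h.symm ▸ Set.mem_univ y : y ∈ Uᶜ) hyU

/-- Modulo `localCommutator F`, elements of `F` with proper clopen supports commute. -/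
lemma commutator_mem_of_supportedIn (hF : IsFlexible F) {A B : Set X} (hA : IsClopen A)
    (hA' : A ≠ Set.univ) (hB : IsClopen B) (hB' : B ≠ Set.univ) {a b : X ≃ₜ X} (ha : a ∈ F)
    (hb : b ∈ F) (hsa : SupportedIn A a) (hsb : SupportedIn B b) :
    ⁅a, b⁆ ∈ localCommutator F := by
  have hunion {A' : Set X} {a' : X ≃ₜ X} (hA : IsClopen A') (ha : a' ∈ F)
      (hsa : SupportedIn A' a') (hne : A' ∪ B ≠ Set.univ) : ⁅a', b⁆ ∈ localCommutator F :=
    commutator_mem_localCommutator (hA.union hB) hne ha hb (hsa.mono Set.subset_union_left)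
      (hsb.mono Set.subset_union_right)
  by_cases hAB : A ∪ B = Set.univ
  swap
  · exact hunion hA ha hsa hAB
  obtain ⟨y, hyB⟩ := (Set.ne_univ_iff_exists_notMem B).1 hB'
  have hyA : y ∈ A := (hAB.symm ▸ Set.mem_univ y : y ∈ A ∪ B).resolve_right hyB
  obtain ⟨V, W, hV, -, hVne, ⟨w, hw⟩, hVA, hWA, hVW⟩ := exists_disjoint_clopen_subsets
    hA.isClosed.isOpen_compl (Set.nonempty_compl.2 hA')
  obtain ⟨t, ht, htV, htt, hst⟩ := hF.exists_swap hA hV.isOpen hVne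
    (Set.disjoint_right.2 fun z hz => hVA hz)
  have hC : A ∪ V ≠ Set.univ := (Set.ne_univ_iff_exists_notMem _).2
    ⟨w, fun h => h.elim (fun h => hWA hw h) (hVW.notMem_of_mem_right hw)⟩
  have hk : ⁅t, a⁆ ∈ localCommutator F := commutator_mem_localCommutator (hA.union hV) hC ht ha
    hst (hsa.mono Set.subset_union_left)
  have hconj : ⁅t * a * t⁻¹, b⁆ ∈ localCommutator F := by
    refine hunion hV (mul_mem (mul_mem ht ha) (inv_mem ht)) (hsa.conj t htV) ?_
    exact (Set.ne_univ_iff_exists_notMem _).2 ⟨y, fun h => h.elim (fun h => hVA h hyA) hyB⟩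
  have heq : a = ⁅t, a⁆⁻¹ * (t * a * t⁻¹) := by
    simp only [commutatorElement_def]; group
  rw [heq]
  refine mul_commutator_mem (fun k hk' => ?_) ?_ hconj
  · exact mul_mem (mul_mem (inv_mem hk) hk') (inv_mem (inv_mem hk))
  · have : ⁅⁅t, a⁆⁻¹, b⁆ = ⁅t, a⁆⁻¹ * (b * ⁅t, a⁆ * b⁻¹) := by
      simp only [commutatorElement_def]; group
    rw [this]
    exact mul_mem (inv_mem hk) (conj_mem_localCommutator hk hb)

lemma commutator_le_localCommutator [Nonempty X] (hF : IsFlexible F) :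
    ⁅F, F⁆ ≤ localCommutator F := by
  refine Subgroup.commutator_le.2 fun f hf g hg => ?_
  obtain ⟨A₁, A₂, hA₁, hA₁', hA₂, hA₂', a₁, ha₁, a₂, ha₂, hs₁, hs₂, rfl⟩ :=
    hF.exists_fragmentation hf
  obtain ⟨B₁, B₂, hB₁, hB₁', hB₂, hB₂', b₁, hb₁, b₂, hb₂, ht₁, ht₂, rfl⟩ :=
    hF.exists_fragmentation hg
  refine mul_commutator_mem (fun k hk => conj_mem_localCommutator hk ha₁) ?_ ?_ <;>
  refine commutator_mem_of_commutator_mem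
    (mul_commutator_mem (fun k hk => conj_mem_localCommutator hk hb₁) ?_ ?_)
  · exact hF.commutator_mem_of_supportedIn hB₁ hB₁' hA₁ hA₁' hb₁ ha₁ ht₁ hs₁
  · exact hF.commutator_mem_of_supportedIn hB₂ hB₂' hA₁ hA₁' hb₂ ha₁ ht₂ hs₁
  · exact hF.commutator_mem_of_supportedIn hB₁ hB₁' hA₂ hA₂' hb₁ ha₂ ht₁ hs₂
  · exact hF.commutator_mem_of_supportedIn hB₂ hB₂' hA₂ hA₂' hb₂ ha₂ ht₂ hs₂

/-- A nontrivial subgroup normalised by `⁅F, F⁆` contains all local commutators. -/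
lemma localCommutator_le (hF : IsFlexible F) {N : Subgroup (X ≃ₜ X)}
    (hN : ∀ d ∈ ⁅F, F⁆, ∀ g ∈ N, d * g * d⁻¹ ∈ N) {g : X ≃ₜ X} (hg : g ∈ N) (hg1 : g ≠ 1) :
    localCommutator F ≤ N := by
  obtain ⟨y, hy⟩ : ∃ y, g y ≠ y := by
    by_contra! h
    exact hg1 (Homeomorph.ext h)
  obtain ⟨U, hU, hyU, hdU, -⟩ := exists_clopen_disjoint_image hy
  obtain ⟨W, V, hW, hV, hWne, hVne, hWU, hVU, hWV⟩ :=
    exists_disjoint_clopen_subsets hU.isOpen ⟨y, hyU⟩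
  obtain ⟨V₁, V₂, hV₁, hV₂, hV₁ne, hV₂ne, hV₁V, hV₂V, hV₁₂⟩ :=
    exists_disjoint_clopen_subsets hV.isOpen hVne
  obtain ⟨t₁, ht₁, htV₁, -, -⟩ :=
    hF.exists_swap hW hV₁.isOpen hV₁ne (hWV.mono_right hV₁V)
  obtain ⟨t₂, ht₂, htV₂, -, -⟩ :=
    hF.exists_swap hW hV₂.isOpen hV₂ne (hWV.mono_right hV₂V)
  have hcomm {a b : X ≃ₜ X} (ha : a ∈ F) (hb : b ∈ F) (hsa : SupportedIn W a)
      (hsb : SupportedIn W b) : ⁅a, b⁆ ∈ N := by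
    have hsp : SupportedIn V₁ (t₁ * a⁻¹ * t₁⁻¹) := hsa.inv.conj t₁ htV₁
    have hsq : SupportedIn V₂ (t₂ * b⁻¹ * t₂⁻¹) := hsb.inv.conj t₂ htV₂
    have hda : ⁅a, t₁⁆ ∈ ⁅F, F⁆ := Subgroup.commutator_mem_commutator ha ht₁
    have ha' : ⁅a, t₁⁆ = a * (t₁ * a⁻¹ * t₁⁻¹) := by simp only [commutatorElement_def, mul_assoc]
    have hb' : ⁅b, t₂⁆ = b * (t₂ * b⁻¹ * t₂⁻¹) := by simp only [commutatorElement_def, mul_assoc]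
    have hsa' : SupportedIn U ⁅a, t₁⁆ :=
      ha' ▸ (hsa.mono hWU).mul (hsp.mono (hV₁V.trans hVU))
    have hsb' : SupportedIn (W ∪ V₂) ⁅b, t₂⁆ :=
      hb' ▸ (hsb.mono Set.subset_union_left).mul (hsq.mono Set.subset_union_right)
    have hsb'' : SupportedIn U ⁅b, t₂⁆ := hsb'.mono (Set.union_subset hWU (hV₂V.trans hVU))
    have h₁ : ⁅⁅a, t₁⁆, ⁅b, t₂⁆⁆ = ⁅a, b⁆ := by
      have hc : Commute (t₁ * a⁻¹ * t₁⁻¹) ⁅b, t₂⁆ := hsp.commute hsb'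
        (Set.disjoint_union_right.2 ⟨(hWV.mono_right hV₁V).symm, hV₁₂⟩)
      rw [ha', commutator_mul_left_of_commute hc, hb', commutator_mul_right_of_commute
        (hsa.commute hsq (hWV.mono_right hV₂V))]
    have h₂ : ⁅⁅⁅a, t₁⁆, g⁆, ⁅b, t₂⁆⁆ = ⁅⁅a, t₁⁆, ⁅b, t₂⁆⁆ := by
      have hc : SupportedIn (g '' U) (g * ⁅a, t₁⁆⁻¹ * g⁻¹) :=
        hsa'.inv.conj g fun x hx => Set.mem_image_of_mem g hx
      have heq : ⁅⁅a, t₁⁆, g⁆ = ⁅a, t₁⁆ * (g * ⁅a, t₁⁆⁻¹ * g⁻¹) := by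
        rw [commutatorElement_def ⁅a, t₁⁆ g]; group
      rw [heq, commutator_mul_left_of_commute (hc.commute hsb'' hdU.symm)]
    have hn : ⁅⁅a, t₁⁆, g⁆ ∈ N := mul_mem (hN _ hda g hg) (inv_mem hg)
    have hdb : ⁅b, t₂⁆ ∈ ⁅F, F⁆ := Subgroup.commutator_mem_commutator hb ht₂
    rw [← h₁, ← h₂]
    exact commutator_mem_of_commutator_mem (mul_mem (hN _ hdb _ hn) (inv_mem hn))
  have hle : ⁅F, F⁆ ≤ F := Subgroup.commutator_le.2 fun a ha b hb =>
    mul_mem (mul_mem (mul_mem ha hb) (inv_mem ha)) (inv_mem hb)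
  refine (Subgroup.closure_le _).2 ?_
  rintro _ ⟨A, hA, hA', a, ha, b, hb, hsa, hsb, rfl⟩
  obtain ⟨d, hd, hdW⟩ := hF.exists_commutator_move hA hA' hW.isOpen hWne
  have hdF : d ∈ F := hle hd
  have h := hN _ (inv_mem hd) _ (hcomm (mul_mem (mul_mem hdF ha) (inv_mem hdF))
    (mul_mem (mul_mem hdF hb) (inv_mem hdF)) (hsa.conj d hdW) (hsb.conj d hdW))
  have heq : ⁅a, b⁆ = d⁻¹ * ⁅d * a * d⁻¹, d * b * d⁻¹⁆ * d⁻¹⁻¹ := by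
    simp only [commutatorElement_def]; group
  exact heq ▸ h

theorem isSimpleGroup_commutator [Nonempty X] (hF : IsFlexible F) :
    IsSimpleGroup ↥⁅F, F⁆ := by
  have hnt : Nontrivial ↥⁅F, F⁆ := by
    obtain ⟨A, V, hA, hV, ⟨x, hx⟩, hVne, -, -, hd⟩ :=
      exists_disjoint_clopen_subsets (X := X) isOpen_univ Set.univ_nonempty
    obtain ⟨d, hdF, hdV⟩ := hF.exists_commutator_move_of_disjoint hA hV.isOpen hVne hd
    refine ⟨⟨d, hdF⟩, 1, fun h => hd.notMem_of_mem_left hx ?_⟩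
    have h1 : d = 1 := congrArg Subtype.val h
    simpa [h1] using hdV x hx
  refine { eq_bot_or_eq_top_of_normal := fun H hH => or_iff_not_imp_left.2 fun hbot => ?_ }
  obtain ⟨g, hg, hg1⟩ := H.bot_or_exists_ne_one.resolve_left hbot
  have hle : ⁅F, F⁆ ≤ H.map ⁅F, F⁆.subtype := by
    refine hF.commutator_le_localCommutator.trans (hF.localCommutator_le ?_
      (Subgroup.mem_map_of_mem _ hg) fun h => hg1 (Subtype.ext h))
    rintro d hd _ ⟨k, hk, rfl⟩
    exact ⟨⟨d, hd⟩ * k * ⟨d, hd⟩⁻¹, hH.conj_mem k hk _, rfl⟩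
  refine eq_top_iff.2 fun x _ => ?_
  obtain ⟨k, hk, hkx⟩ := hle x.2
  exact Subtype.ext hkx ▸ hk

end IsFlexible

end CantorLike

end FlexibleGroups

section Words

variable {n : ℕ}

/-- The infinite word obtained by deleting the first `k` letters. -/
def dropInf (k : ℕ) (χ : Cantor n) : Cantor n := fun i => χ (i + k)

lemma prefixOf_appendInf (w : List (Fin n)) (χ : Cantor n) : PrefixOf w (appendInf w χ) :=
  fun i h => by simp [appendInf, h]

lemma dropInf_appendInf (w : List (Fin n)) (χ : Cantor n) :
    dropInf w.length (appendInf w χ) = χ := by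
  funext i
  simp [dropInf, appendInf]

lemma PrefixOf.appendInf_dropInf {w : List (Fin n)} {χ : Cantor n} (h : PrefixOf w χ) :
    appendInf w (dropInf w.length χ) = χ := by
  funext i
  by_cases hi : i < w.length
  · simpa [appendInf, hi] using h i hi
  · simp [appendInf, dropInf, hi, Nat.sub_add_cancel (not_lt.1 hi)]

lemma appendInf_append (u v : List (Fin n)) (χ : Cantor n) :
    appendInf (u ++ v) χ = appendInf u (appendInf v χ) := by
  funext i
  simp only [appendInf, List.length_append, List.get_eq_getElem]
  by_cases h1 : i < u.length
  · simp [h1, Nat.lt_add_right _ h1, List.getElem_append_left]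
  · by_cases h2 : i - u.length < v.length
    · have h3 : i < u.length + v.length := by omega
      simp [h1, h2, h3, List.getElem_append_right (not_lt.1 h1)]
    · have h3 : ¬ i < u.length + v.length := by omega
      simp [h1, h2, h3, Nat.sub_sub]

lemma prefixOf_append_singleton {w : List (Fin n)} {x : Fin n} {χ : Cantor n} :
    PrefixOf (w ++ [x]) χ ↔ PrefixOf w χ ∧ x = χ w.length := by
  constructor
  · intro h
    refine ⟨fun i hi => ?_, ?_⟩
    · have := h i (by simp; omega)
      simpa [List.getElem_append_left hi] using this
    · simpa using h w.length (by simp)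
  · rintro ⟨h, hx⟩ i hi
    rcases Nat.lt_or_ge i w.length with h1 | h1
    · simpa [List.getElem_append_left h1] using h i h1
    · have : i = w.length := by simp at hi; omega
      subst this
      simpa using hx

lemma prefixOf_takeW (χ : Cantor n) (k : ℕ) : PrefixOf (takeW χ k) χ :=
  fun i h => by simp [takeW]

lemma length_takeW (χ : Cantor n) (k : ℕ) : (takeW χ k).length = k := by
  simp [takeW]

lemma takeW_appendInf_singleton (x : Fin n) (χ : Cantor n) (k : ℕ) :
    takeW (appendInf [x] χ) (k + 1) = x :: takeW χ k := by
  simp [takeW, appendInf, List.ofFn_succ]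

lemma takeW_prefix (χ : Cantor n) {k m : ℕ} (h : k ≤ m) : takeW χ k <+: takeW χ m := by
  rw [List.prefix_iff_eq_take]
  refine List.ext_getElem (by simp [length_takeW, h]) fun i h1 h2 => ?_
  simp [takeW]

lemma continuous_dropInf (k : ℕ) : Continuous (dropInf k : Cantor n → Cantor n) :=
  continuous_pi fun i => continuous_apply (i + k)

lemma continuous_appendInf (w : List (Fin n)) : Continuous (appendInf w) := by
  refine continuous_pi fun i => ?_
  by_cases h : i < w.length
  · simp only [appendInf, h, dif_pos]
    exact continuous_const
  · simp only [appendInf, h, dif_neg, not_false_eq_true]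
    exact continuous_apply _

lemma isClopen_cone (w : List (Fin n)) : IsClopen (cone w) := by
  have : cone w = ⋂ i : Fin w.length, (fun χ : Cantor n => χ i) ⁻¹' {w.get i} := by
    ext χ
    simp [cone, PrefixOf, Fin.forall_iff, eq_comm]
  rw [this]
  exact isClopen_iInter_of_finite fun i =>
    (isClopen_discrete {w.get i}).preimage (continuous_apply (i : ℕ))

lemma exists_cone_takeW_subset {U : Set (Cantor n)} (hU : IsOpen U) {χ : Cantor n} (hχ : χ ∈ U) :
    ∃ k, 1 ≤ k ∧ cone (takeW χ k) ⊆ U := by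
  obtain ⟨I, u, hu, hsub⟩ := isOpen_pi_iff.1 hU χ hχ
  refine ⟨I.sup id + 1, by omega, fun ψ hψ => hsub fun i hi => ?_⟩
  have hi' : i ≤ I.sup id := Finset.le_sup (f := id) hi
  have := hψ i (by rw [length_takeW]; omega)
  have heq : χ i = ψ i := by
    simpa only [takeW, List.get_eq_getElem, List.getElem_ofFn] using this
  exact heq ▸ (hu i hi).2

lemma perfectSpace_cantor (hn : 2 ≤ n) : PerfectSpace (Cantor n) := by
  have : Nontrivial (Fin n) := Fin.nontrivial_iff_two_le.2 hn
  refine ⟨preperfect_iff_nhds.2 fun χ _ U hU => ?_⟩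
  obtain ⟨O, hOU, hO, hχ⟩ := mem_nhds_iff.1 hU
  obtain ⟨k, -, hk⟩ := exists_cone_takeW_subset hO hχ
  obtain ⟨a, ha⟩ := exists_ne (χ k)
  refine ⟨Function.update χ k a, ⟨hOU (hk fun i hi => ?_), trivial⟩, fun h => ha ?_⟩
  · rw [length_takeW] at hi
    simp [takeW, hi.ne]
  · simpa using congrFun h k

end Words

section Antichains

variable {n : ℕ}

/-- A finite set of words such that every infinite word has exactly one prefix in the set. -/
def MaxAntichain (P : Finset (List (Fin n))) : Prop :=
  ∀ χ : Cantor n, ∃! w, w ∈ P ∧ PrefixOf w χ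

/-- Replace the word `w` of `P` by its one-letter extensions. -/
def splitWord (P : Finset (List (Fin n))) (w : List (Fin n)) : Finset (List (Fin n)) :=
  P.erase w ∪ Finset.univ.image fun x => w ++ [x]

lemma mem_splitWord {P : Finset (List (Fin n))} {w u : List (Fin n)} :
    u ∈ splitWord P w ↔ u ≠ w ∧ u ∈ P ∨ ∃ x, w ++ [x] = u := by
  simp [splitWord]

lemma maxAntichain_singleton_nil : MaxAntichain ({[]} : Finset (List (Fin n))) := fun χ =>
  ⟨[], ⟨by simp, fun i hi => by simp at hi⟩, fun w hw => by simpa using hw.1⟩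

namespace MaxAntichain

variable {P : Finset (List (Fin n))} {w : List (Fin n)}

lemma eq_of_prefixOf (hP : MaxAntichain P) {u v : List (Fin n)} (hu : u ∈ P) (hv : v ∈ P)
    {χ : Cantor n} (hu' : PrefixOf u χ) (hv' : PrefixOf v χ) : u = v :=
  (hP χ).unique ⟨hu, hu'⟩ ⟨hv, hv'⟩

lemma maxAntichain_splitWord (hP : MaxAntichain P) (hw : w ∈ P) : MaxAntichain (splitWord P w) := fun χ => by
  obtain ⟨u, ⟨hu, huχ⟩, -⟩ := hP χ
  by_cases huw : u = w
  · subst huw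
    refine ⟨u ++ [χ u.length], ⟨mem_splitWord.2 (.inr ⟨_, rfl⟩),
      prefixOf_append_singleton.2 ⟨huχ, rfl⟩⟩, ?_⟩
    rintro v ⟨hv, hvχ⟩
    rcases mem_splitWord.1 hv with ⟨hne, hv⟩ | ⟨x, rfl⟩
    · exact absurd (hP.eq_of_prefixOf hv hu hvχ huχ) hne
    · rw [(prefixOf_append_singleton.1 hvχ).2]
  · refine ⟨u, ⟨mem_splitWord.2 (.inl ⟨huw, hu⟩), huχ⟩, ?_⟩
    rintro v ⟨hv, hvχ⟩
    rcases mem_splitWord.1 hv with ⟨-, hv⟩ | ⟨x, rfl⟩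
    · exact hP.eq_of_prefixOf hv hu hvχ huχ
    · exact absurd (hP.eq_of_prefixOf hu hw huχ (prefixOf_append_singleton.1 hvχ).1) huw

lemma card_splitWord (hn : 2 ≤ n) (hP : MaxAntichain P) (hw : w ∈ P) :
    (splitWord P w).card = P.card + (n - 1) := by
  have hd : Disjoint (P.erase w) (Finset.univ.image fun x => w ++ [x]) := by
    refine Finset.disjoint_right.2 fun u hu hu' => ?_
    obtain ⟨x, -, rfl⟩ := Finset.mem_image.1 hu
    have h := prefixOf_appendInf (w ++ [x]) fun _ => x
    exact (Finset.mem_erase.1 hu').1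
      (hP.eq_of_prefixOf (Finset.mem_erase.1 hu').2 hw h (prefixOf_append_singleton.1 h).1)
  have hinj : Function.Injective fun x : Fin n => w ++ [x] := fun x y h => by simpa using h
  rw [splitWord, Finset.card_union_of_disjoint hd, Finset.card_erase_of_mem hw,
    Finset.card_image_of_injective _ hinj, Finset.card_univ, Fintype.card_fin]
  have := Finset.card_pos.2 ⟨w, hw⟩
  omega

end MaxAntichain

lemma exists_maxAntichain_mem (hn : 2 ≤ n) (w : List (Fin n)) :
    ∃ P, MaxAntichain P ∧ w ∈ P ∧ P.card = 1 + w.length * (n - 1) := by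
  induction w using List.reverseRecOn with
  | nil => exact ⟨{[]}, maxAntichain_singleton_nil, by simp, by simp⟩
  | append_singleton w x ih =>
    obtain ⟨P, hP, hw, hc⟩ := ih
    refine ⟨splitWord P w, hP.maxAntichain_splitWord hw, mem_splitWord.2 (.inr ⟨x, rfl⟩), ?_⟩
    rw [hP.card_splitWord hn hw, hc, List.length_append, List.length_singleton]
    ring

lemma exists_maxAntichain_mem_card (hn : 2 ≤ n) {w : List (Fin n)} (hw : w ≠ []) {m : ℕ}
    (hm : w.length ≤ m) : ∃ P, MaxAntichain P ∧ w ∈ P ∧ P.card = 1 + m * (n - 1) := by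
  induction m, hm using Nat.le_induction with
  | base => exact exists_maxAntichain_mem hn w
  | succ m hm ih =>
    obtain ⟨P, hP, hwP, hc⟩ := ih
    have h1 : 1 < P.card := by
      have : 0 < m * (n - 1) :=
        Nat.mul_pos ((List.length_pos_iff.2 hw).trans_le hm) (by omega)
      omega
    obtain ⟨u, hu, huw⟩ := Finset.exists_mem_ne h1 w
    refine ⟨splitWord P u, hP.maxAntichain_splitWord hu, mem_splitWord.2 (.inl ⟨huw.symm, hwP⟩), ?_⟩
    rw [hP.card_splitWord hn hu, hc]
    ring

/-- Splitting preserves any property of words inherited by one-letter extensions. -/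
lemma MaxAntichain.exists_refinement (hn : 2 ≤ n) {S : List (Fin n) → Prop}
    (hS : ∀ w x, S w → S (w ++ [x])) {P : Finset (List (Fin n))} (hP : MaxAntichain P)
    (hPS : ∀ w ∈ P, S w) (k : ℕ) :
    ∃ R, MaxAntichain R ∧ (∀ w ∈ R, S w) ∧ R.card = P.card + k * (n - 1) := by
  induction k with
  | zero => exact ⟨P, hP, hPS, by simp⟩
  | succ k ih =>
    obtain ⟨R, hR, hRS, hc⟩ := ih
    obtain ⟨w, ⟨hw, -⟩, -⟩ := hR fun _ => ⟨0, by omega⟩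
    refine ⟨splitWord R w, hR.maxAntichain_splitWord hw, fun u hu => ?_, ?_⟩
    · rcases mem_splitWord.1 hu with ⟨-, hu⟩ | ⟨x, rfl⟩
      · exact hRS u hu
      · exact hS w x (hRS w hw)
    · rw [hR.card_splitWord hn hw, hc]
      ring

lemma MaxAntichain.exists_prefixMap {P : Finset (List (Fin n))} (hP : MaxAntichain P)
    (e : P → List (Fin n)) :
    ∃ f : Cantor n → Cantor n, Continuous f ∧
      ∀ (w : P) (χ : Cantor n), f (appendInf w χ) = appendInf (e w) χ := by
  choose p hp using fun χ => (hP χ).exists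
  let f : Cantor n → Cantor n := fun χ =>
    appendInf (e ⟨p χ, (hp χ).1⟩) (dropInf (p χ).length χ)
  have hf (w : P) (χ : Cantor n) : f (appendInf w χ) = appendInf (e w) χ := by
    have h : p (appendInf w χ) = w :=
      hP.eq_of_prefixOf (hp _).1 w.2 (hp _).2 (prefixOf_appendInf _ _)
    simp only [f, h, dropInf_appendInf]
  refine ⟨f, continuous_iff_continuousAt.2 fun χ => ?_, hf⟩
  have hcont : Continuous fun ψ => appendInf (e ⟨p χ, (hp χ).1⟩) (dropInf (p χ).length ψ) :=
    (continuous_appendInf _).comp (continuous_dropInf _)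
  refine hcont.continuousAt.congr ?_
  filter_upwards [(isClopen_cone (p χ)).isOpen.mem_nhds (hp χ).2] with ψ hψ
  have hψ' : PrefixOf (p χ) ψ := hψ
  conv_rhs => rw [← hψ'.appendInf_dropInf]
  exact (hf ⟨p χ, (hp χ).1⟩ _).symm

/-- A bijection between maximal antichains induces a prefix replacement homeomorphism. -/
lemma MaxAntichain.exists_homeomorph {P R : Finset (List (Fin n))} (hP : MaxAntichain P)
    (hR : MaxAntichain R) (e : P ≃ R) :
    ∃ v : Cantor n ≃ₜ Cantor n,
      ∀ (w : P) (χ : Cantor n), v (appendInf w χ) = appendInf (e w) χ := by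
  obtain ⟨f, hf, hf'⟩ := hP.exists_prefixMap fun w => e w
  obtain ⟨g, hg, hg'⟩ := hR.exists_prefixMap fun w => e.symm w
  refine ⟨⟨⟨f, g, fun χ => ?_, fun χ => ?_⟩, hf, hg⟩, hf'⟩
  · obtain ⟨w, ⟨hw, hwχ⟩, -⟩ := hP χ
    rw [← hwχ.appendInf_dropInf, hf' ⟨w, hw⟩, hg', Equiv.symm_apply_apply]
  · obtain ⟨w, ⟨hw, hwχ⟩, -⟩ := hR χ
    rw [← hwχ.appendInf_dropInf, hg' ⟨w, hw⟩, hf', Equiv.apply_symm_apply]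

end Antichains

section LocalGroup

variable {n : ℕ}

/-- The group of all homeomorphisms which locally agree with `G`. -/
def localGroup (G : Subgroup (Cantor n ≃ₜ Cantor n)) : Subgroup (Cantor n ≃ₜ Cantor n) where
  carrier := {f | LocallyAgrees (↑G) f}
  one_mem' := fun x => ⟨Set.univ, isOpen_univ, trivial, 1, G.one_mem, fun _ _ => rfl⟩
  mul_mem' := by
    intro a b ha hb x
    obtain ⟨U, hU, hxU, g, hg, hbg⟩ := hb x
    obtain ⟨V, hV, hxV, g', hg', hag⟩ := ha (b x)
    refine ⟨U ∩ b ⁻¹' V, hU.inter (hV.preimage b.continuous), ⟨hxU, hxV⟩, g' * g,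
      G.mul_mem hg' hg, fun z hz => ?_⟩
    rw [homeo_mul_apply, homeo_mul_apply, ← hbg hz.1, hag hz.2]
  inv_mem' := by
    intro a ha x
    obtain ⟨U, hU, hxU, g, hg, hag⟩ := ha (a⁻¹ x)
    refine ⟨a '' U, a.isOpenMap _ hU, ⟨_, hxU, by simp⟩, g⁻¹, G.inv_mem hg, ?_⟩
    rintro _ ⟨z, hz, rfl⟩
    rw [homeo_inv_apply_self, hag hz, homeo_inv_apply_self]

lemma le_localGroup (G : Subgroup (Cantor n ≃ₜ Cantor n)) : G ≤ localGroup G := fun g hg _ =>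
  ⟨Set.univ, isOpen_univ, trivial, g, hg, fun _ _ => rfl⟩

lemma locallyClosed_localGroup (G : Subgroup (Cantor n ≃ₜ Cantor n)) :
    LocallyClosed (localGroup G) := by
  intro f hf x
  obtain ⟨U, hU, hxU, g, hg, hfg⟩ := hf x
  obtain ⟨V, hV, hxV, g', hg', hgg⟩ := hg x
  exact ⟨U ∩ V, hU.inter hV, ⟨hxU, hxV⟩, g', hg', fun z hz => (hfg hz.1).trans (hgg hz.2)⟩

/-- If `G` contains prefix replacements between any two nonempty words, then the group of
homeomorphisms which locally agree with `G` is flexible. -/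
lemma isFlexible_localGroup {G : Subgroup (Cantor n ≃ₜ Cantor n)}
    (hG : ∀ u w : List (Fin n), u ≠ [] → w ≠ [] →
      ∃ v ∈ G, ∀ χ : Cantor n, v (appendInf u χ) = appendInf w χ) :
    IsFlexible (localGroup G) := by
  refine ⟨locallyClosed_localGroup G, fun A V hA hV ⟨ψ, hψ⟩ hAV => ?_⟩
  obtain ⟨m, hm, hmV⟩ := exists_cone_takeW_subset hV hψ
  set w := takeW ψ m with hw
  have hB : IsClopen (cone w ∩ dropInf w.length ⁻¹' A) :=
    (isClopen_cone w).inter (hA.preimage (continuous_dropInf _))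
  have hBV : cone w ∩ dropInf w.length ⁻¹' A ⊆ V := Set.inter_subset_left.trans hmV
  have hjB (x : Cantor n) (hx : x ∈ A) : appendInf w x ∈ cone w ∩ dropInf w.length ⁻¹' A :=
    ⟨prefixOf_appendInf w x, by rwa [Set.mem_preimage, dropInf_appendInf]⟩
  refine ⟨_, (locallyClosed_localGroup G).clopenSwap_mem hA hB (hAV.mono_right hBV)
    (continuous_appendInf w) (continuous_dropInf w.length) hjB (fun x hx => hx.2)
    (fun x _ => dropInf_appendInf w x) (fun x hx => hx.1.appendInf_dropInf)
    (fun x _ => ?_), fun x hx => ?_⟩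
  · have hne : takeW x 1 ≠ [] := List.ne_nil_of_length_pos (by simp [length_takeW])
    obtain ⟨v, hv, hvx⟩ := hG (takeW x 1) (w ++ takeW x 1) hne (by simp [hne])
    refine ⟨cone (takeW x 1), (isClopen_cone _).isOpen, prefixOf_takeW x 1, v,
      le_localGroup G hv, fun z hz => ?_⟩
    have hz' : PrefixOf (takeW x 1) z := hz
    rw [← hz'.appendInf_dropInf, hvx, appendInf_append]
  · rw [clopenSwap_apply_left hx]
    exact hBV (hjB x hx)

end LocalGroup

namespace Transducer

section Completions

variable {n : ℕ} {T : Transducer n}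

lemma outStar_append (T : Transducer n) (u v : List (Fin n)) (q : T.Q) :
    T.outStar (u ++ v) q = T.outStar u q ++ T.outStar v (T.transStar u q) := by
  induction u generalizing q with
  | nil => rfl
  | cons x u ih => simp [outStar, transStar, ih]

lemma outStar_prefix (T : Transducer n) {u v : List (Fin n)} (h : u <+: v) (q : T.Q) :
    T.outStar u q <+: T.outStar v q := by
  obtain ⟨t, rfl⟩ := h
  rw [outStar_append]
  exact List.prefix_append _ _

/-- The map induced by a state is determined by any output word that is long enough. -/
lemma Induces.apply_eq {q : T.Q} {f : Cantor n → Cantor n} (h : T.Induces q f) (χ : Cantor n)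
    {k i : ℕ} (hi : i < (T.outStar (takeW χ k) q).length) :
    f χ i = (T.outStar (takeW χ k) q)[i] := by
  obtain ⟨m, hm, hpre⟩ := h χ (i + 1)
  rw [← hpre i hm, List.get_eq_getElem]
  rcases le_total k m with hkm | hkm
  · exact ((T.outStar_prefix (takeW_prefix χ hkm) q).getElem hi).symm
  · exact (T.outStar_prefix (takeW_prefix χ hkm) q).getElem hm

lemma Induces.appendInf_singleton {q : T.Q} {x : Fin n} {f f' : Cantor n → Cantor n}
    (h : T.Induces q f) (h' : T.Induces (T.tr x q) f') (χ : Cantor n) :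
    f (appendInf [x] χ) = appendInf (T.out x q) (f' χ) := by
  funext i
  obtain ⟨k, hk, -⟩ := h' χ (i + 1)
  have heq : T.outStar (takeW (appendInf [x] χ) (k + 1)) q =
      T.out x q ++ T.outStar (takeW χ k) (T.tr x q) := by
    rw [takeW_appendInf_singleton, outStar]
  have hi : i < (T.outStar (takeW (appendInf [x] χ) (k + 1)) q).length := by
    rw [heq, List.length_append]
    omega
  rw [h.apply_eq _ hi]
  simp only [heq, List.getElem_append, appendInf, List.get_eq_getElem]
  split_ifs with h1
  · rfl
  · exact (h'.apply_eq χ (by omega)).symm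

/-- Up to a finite prefix, `h` acts on the cone of `w` as a state of `T`. -/
def ActsByState (T : Transducer n) (h : Cantor n → Cantor n) (w : List (Fin n)) : Prop :=
  ∃ (ρ : List (Fin n)) (p : T.Q) (f : Cantor n → Cantor n), T.Induces p f ∧
    ∀ χ, h (appendInf w χ) = appendInf ρ (f χ)

lemma ActsByState.append_singleton (hPI : T.PartiallyInvertible) {h : Cantor n → Cantor n}
    {w : List (Fin n)} (hw : T.ActsByState h w) (x : Fin n) : T.ActsByState h (w ++ [x]) := by
  obtain ⟨ρ, p, f, hf, hh⟩ := hw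
  obtain ⟨f', hf', -⟩ := hPI (T.tr x p)
  refine ⟨ρ ++ T.out x p, T.tr x p, f', hf', fun χ => ?_⟩
  rw [appendInf_append, hh, hf.appendInf_singleton hf', appendInf_append]

lemma isCompletion_of_actsByState {P : Finset (List (Fin n))} (hP : MaxAntichain P) {k : ℕ}
    (hc : P.card = 1 + k * (n - 1)) {h : Cantor n ≃ₜ Cantor n}
    (hPS : ∀ w ∈ P, T.ActsByState h w) : T.IsCompletion h := by
  choose ρ p f hf hh using fun w : P => hPS w w.2
  let e := P.equivFin.symm
  have himage (w : P) : appendInf (ρ w) '' Set.range (f w) = h '' cone w.1 := by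
    ext y
    constructor
    · rintro ⟨_, ⟨χ, rfl⟩, rfl⟩
      exact ⟨_, prefixOf_appendInf w.1 χ, hh w χ⟩
    · rintro ⟨χ, hχ, rfl⟩
      have hχ' : PrefixOf w.1 χ := hχ
      exact ⟨_, ⟨_, rfl⟩, by rw [← hh, hχ'.appendInf_dropInf]⟩
  refine ⟨P.card, fun i => (e i).1, fun i => ρ (e i), fun i => p (e i), fun i => f (e i),
    ?_, fun χ => ?_, fun i => hf _, ?_, fun i j hij => ?_, fun i χ => hh _ χ⟩
  · rw [hc, Nat.add_mul_mod_self_right]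
  · obtain ⟨w, ⟨hw, hwχ⟩, -⟩ := hP χ
    refine ⟨e.symm ⟨w, hw⟩, by simpa using hwχ, fun j hj => ?_⟩
    rw [Equiv.eq_symm_apply]
    exact Subtype.ext (hP.eq_of_prefixOf (e j).2 hw hj hwχ)
  · simp only [himage, ← Set.image_iUnion]
    refine Set.eq_univ_of_forall fun y => ?_
    obtain ⟨w, ⟨hw, hwχ⟩, -⟩ := hP (h.symm y)
    exact ⟨h.symm y, Set.mem_iUnion.2 ⟨e.symm ⟨w, hw⟩, by simpa [cone] using hwχ⟩,
      h.apply_symm_apply y⟩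
  · simp only [himage]
    refine (Set.disjoint_image_iff h.injective).2 (Set.disjoint_left.2 fun χ hi hj => hij ?_)
    exact e.injective (Subtype.ext (hP.eq_of_prefixOf (e i).2 (e j).2 hi hj))

lemma IsCompletion.exists_maxAntichain (hn : 2 ≤ n) {h : Cantor n ≃ₜ Cantor n}
    (hh : T.IsCompletion h) :
    ∃ (P : Finset (List (Fin n))) (k : ℕ), MaxAntichain P ∧ P.card = 1 + k * (n - 1) ∧
      ∀ w ∈ P, T.ActsByState h w := by
  obtain ⟨l, η, ρ, p, f, hmod, hη, hf, -, -, hact⟩ := hh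
  let c : Cantor n := fun _ => ⟨0, by omega⟩
  have hinj : Function.Injective η := fun i j hij =>
    (hη (appendInf (η i) c)).unique (prefixOf_appendInf _ _) (hij ▸ prefixOf_appendInf _ _)
  have hl : 1 ≤ l := (Nat.zero_le _).trans_lt (hη c).choose.2
  obtain ⟨k, hk⟩ := (Nat.modEq_iff_dvd' hl).1 (Eq.symm hmod : 1 ≡ l [MOD n - 1])
  refine ⟨Finset.univ.image η, k, fun χ => ?_, ?_, ?_⟩
  · obtain ⟨i, hi, hu⟩ := hη χ
    refine ⟨η i, ⟨by simp, hi⟩, ?_⟩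
    rintro w ⟨hw, hwχ⟩
    obtain ⟨j, -, rfl⟩ := Finset.mem_image.1 hw
    rw [hu j hwχ]
  · rw [Finset.card_image_of_injective _ hinj, Finset.card_univ, Fintype.card_fin, mul_comm,
      ← hk]
    omega
  · intro w hw
    obtain ⟨i, -, rfl⟩ := Finset.mem_image.1 hw
    exact ⟨ρ i, p i, f i, hf i, hact i⟩

/-- `𝓗(T)` contains prefix replacements between any two nonempty words. -/
lemma exists_prefixReplacement_mem_HGroup (hn : 2 ≤ n) (hPI : T.PartiallyInvertible)
    (hex : ∃ h : Cantor n ≃ₜ Cantor n, T.IsCompletion h) {u w : List (Fin n)} (hu : u ≠ [])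
    (hw : w ≠ []) :
    ∃ v ∈ T.HGroup, ∀ χ : Cantor n, v (appendInf u χ) = appendInf w χ := by
  obtain ⟨h, hh⟩ := hex
  obtain ⟨R₀, k, hR₀, hc₀, hS₀⟩ := hh.exists_maxAntichain hn
  obtain ⟨R, hR, hS, hcR⟩ := hR₀.exists_refinement hn
    (S := T.ActsByState h) (fun _ x hw => hw.append_singleton hPI x) hS₀ (u.length + w.length)
  have hcR' : R.card = 1 + (k + u.length + w.length) * (n - 1) := by
    rw [hcR, hc₀]
    ring
  obtain ⟨P, hP, huP, hcP⟩ := exists_maxAntichain_mem_card hn hu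
    (show u.length ≤ k + u.length + w.length by omega)
  obtain ⟨P', hP', hwP', hcP'⟩ := exists_maxAntichain_mem_card hn hw
    (show w.length ≤ k + u.length + w.length by omega)
  let e₀ : P ≃ P' := Finset.equivOfCardEq (hcP.trans hcP'.symm)
  let e : P ≃ P' := e₀.trans (Equiv.swap (e₀ ⟨u, huP⟩) ⟨w, hwP'⟩)
  obtain ⟨v, hv⟩ := hP.exists_homeomorph hP' e
  let e' : P' ≃ R := Finset.equivOfCardEq (hcP'.trans hcR'.symm)
  obtain ⟨t, ht⟩ := hP'.exists_homeomorph hR e'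
  have h₁ : T.IsCompletion (h * t) := isCompletion_of_actsByState hP' hcP' fun y hy => by
    obtain ⟨ρ, p, f, hf, hρ⟩ := hS (e' ⟨y, hy⟩) (e' ⟨y, hy⟩).2
    exact ⟨ρ, p, f, hf, fun χ => by rw [homeo_mul_apply, ht ⟨y, hy⟩, hρ]⟩
  have h₂ : T.IsCompletion (h * t * v) := isCompletion_of_actsByState hP hcP fun y hy => by
    obtain ⟨ρ, p, f, hf, hρ⟩ := hS (e' (e ⟨y, hy⟩)) (e' (e ⟨y, hy⟩)).2
    exact ⟨ρ, p, f, hf, fun χ => by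
      rw [homeo_mul_apply, homeo_mul_apply, hv ⟨y, hy⟩, ht, hρ]⟩
  refine ⟨v, ?_, fun χ => ?_⟩
  · rw [← inv_mul_cancel_left (h * t) v]
    exact T.HGroup.mul_mem (T.HGroup.inv_mem (Subgroup.subset_closure h₁))
      (Subgroup.subset_closure h₂)
  · rw [hv ⟨u, huP⟩]
    simp [e]

end Completions

end Transducer

/-- Corollary 6.5. Let `T ∈ 𝔓ₙ` have a completion in the
homeomorphism group of Cantor space.  Then the derived subgroup `[𝓕(T), 𝓕(T)]` of the
group `𝓕(T)` of all homeomorphisms locally agreeing with `𝓗(T)` is simple. -/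
theorem derived_subgroup_of_FGroup_is_simple
    {n : ℕ} (hn : 2 ≤ n) (T : Transducer n) [Finite T.Q]
    (hPI : T.PartiallyInvertible)
    (hex : ∃ h : Cantor n ≃ₜ Cantor n, T.IsCompletion h) :
    ∃ F : Subgroup (Cantor n ≃ₜ Cantor n),
      (↑F = {f : Cantor n ≃ₜ Cantor n | LocallyAgrees (↑(Transducer.HGroup T)) f}) ∧
      IsSimpleGroup ↥⁅F, F⁆ := by
  have := perfectSpace_cantor hn
  have : Nonempty (Cantor n) := ⟨fun _ => ⟨0, by omega⟩⟩
  exact ⟨localGroup T.HGroup, rfl, IsFlexible.isSimpleGroup_commutator <| isFlexible_localGroup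
    fun _ _ hu hw => Transducer.exists_prefixReplacement_mem_HGroup hn hPI hex hu hw⟩
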